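/- arXiv:1707.01604 — 2 statements merged into one kernel-verified Lean document; each statement's English description precedes it below -/
import Mathlib

section
/- Fix an integer k ≥ 2 and a real number c > 0, and for each n set t_n = ⌊cn + (n/2)·ln k⌋. Then lim_{n→∞} E_{μ_{t_n+1}}[fix²] equals 2 + (3/2)e^{−2c} − (1/4)e^{−4c} if k = 2; equals 2 + 2e^{−2c} + (1/9)e^{−4c} if k = 3; and equals 2 + 3((k−1)/k)e^{−2c} + ((k²−3k+1)/k²)e^{−4c} if k ≥ 4. -/
-- Common setup for the random (n-k)-cycle to transpositions walk on the symmetric group.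
open Finset Filter Real

noncomputable section

/-- Convolution of two (probability) distributions on `S_n`. -/
def conv {n : ℕ} (μ ν : Equiv.Perm (Fin n) → ℝ) : Equiv.Perm (Fin n) → ℝ :=
  fun g => ∑ h : Equiv.Perm (Fin n), μ (g * h⁻¹) * ν h

/-- `t`-fold convolution power (with `μ^{*0}` the point mass at the identity). -/
def convPow {n : ℕ} (μ : Equiv.Perm (Fin n) → ℝ) : ℕ → (Equiv.Perm (Fin n) → ℝ)
  | 0 => fun g => if g = 1 then 1 else 0
  | t + 1 => conv (convPow μ t) μ

/-- Uniform probability distribution on a finite set of permutations. -/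
def unifOn {n : ℕ} (S : Finset (Equiv.Perm (Fin n))) : Equiv.Perm (Fin n) → ℝ :=
  fun g => if g ∈ S then (1 : ℝ) / S.card else 0

/-- The set of `(n-k)`-cycles of `S_n`: one cycle of length `n - k` and `k` fixed points. -/
def cycles (n k : ℕ) : Finset (Equiv.Perm (Fin n)) :=
  letI := Classical.decPred fun σ : Equiv.Perm (Fin n) => σ.IsCycle ∧ σ.support.card = n - k
  Finset.univ.filter fun σ : Equiv.Perm (Fin n) => σ.IsCycle ∧ σ.support.card = n - k

/-- The set of transpositions of `S_n`. -/
def transpositions (n : ℕ) : Finset (Equiv.Perm (Fin n)) :=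
  letI := Classical.decPred fun σ : Equiv.Perm (Fin n) => σ.IsSwap
  Finset.univ.filter fun σ : Equiv.Perm (Fin n) => σ.IsSwap

/-- The law `μ_{t+1} = ν_n * τ_n^{*t}` of the walk after the initial random `(n-k)`-cycle
and `t` random transpositions. -/
def walk (n k t : ℕ) : Equiv.Perm (Fin n) → ℝ :=
  conv (unifOn (cycles n k)) (convPow (unifOn (transpositions n)) t)

/-- The alternating group `A_n` as a finset. -/
def evenPerms (n : ℕ) : Finset (Equiv.Perm (Fin n)) :=
  Finset.univ.filter fun σ => Equiv.Perm.sign σ = 1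

/-- `S_n \ A_n` as a finset. -/
def oddPerms (n : ℕ) : Finset (Equiv.Perm (Fin n)) :=
  Finset.univ.filter fun σ => ¬ (Equiv.Perm.sign σ = 1)

/-- The stationary distribution `U_s` at step `s`: uniform on `A_n` if `s` and `n - k`
have the same parity, uniform on `S_n \ A_n` otherwise. -/
def stationary (n k s : ℕ) : Equiv.Perm (Fin n) → ℝ :=
  if s % 2 = (n - k) % 2 then unifOn (evenPerms n) else unifOn (oddPerms n)

/-- Total variation distance between two distributions on `S_n`. -/
def tvDist {n : ℕ} (μ ν : Equiv.Perm (Fin n) → ℝ) : ℝ :=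
  (1 / 2) * ∑ σ : Equiv.Perm (Fin n), |μ σ - ν σ|

/-- The number of fixed points of a permutation. -/
def fixCount {n : ℕ} (σ : Equiv.Perm (Fin n)) : ℕ :=
  (Finset.univ.filter fun i => σ i = i).card

end

/-- Permutation matrix, `pmat σ i j = [σ j = i]`. -/
def pmat {n : ℕ} (σ : Equiv.Perm (Fin n)) : Matrix (Fin n) (Fin n) ℝ :=
  Matrix.of fun i j => if σ j = i then 1 else 0

theorem pmat_apply {n : ℕ} (σ : Equiv.Perm (Fin n)) (i j : Fin n) :
    pmat σ i j = if σ j = i then 1 else 0 := rfl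

theorem pmat_mul {n : ℕ} (σ τ : Equiv.Perm (Fin n)) : pmat (σ * τ) = pmat σ * pmat τ := by
  ext i j
  rw [Matrix.mul_apply, pmat_apply]
  have h : (σ * τ) j = σ (τ j) := rfl
  rw [h]
  simp [pmat_apply]

theorem trace_pmat {n : ℕ} (σ : Equiv.Perm (Fin n)) :
    (pmat σ).trace = (fixCount σ : ℝ) := by
  simp [Matrix.trace, pmat_apply, fixCount]

/-- The vector `e_a - e_b`. -/
def dvec {n : ℕ} (a b : Fin n) : Fin n → ℝ :=
  fun i => (if i = a then 1 else 0) - (if i = b then 1 else 0)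

theorem pmat_swap {n : ℕ} (a b : Fin n) :
    pmat (Equiv.swap a b) = 1 - Matrix.vecMulVec (dvec a b) (dvec a b) := by
  ext i j
  simp only [pmat_apply, Matrix.sub_apply, Matrix.vecMulVec_apply, dvec, Matrix.one_apply,
    Equiv.swap_apply_def]
  by_cases h1 : j = a <;> by_cases h2 : j = b <;> by_cases h3 : i = a <;> by_cases h4 : i = b <;>
    by_cases h5 : i = j <;> by_cases h6 : a = b <;>
    simp_all [eq_comm]

/-- The quadratic form of `pmat σ` at `e_a - e_b`. -/
def qform {n : ℕ} (σ : Equiv.Perm (Fin n)) (a b : Fin n) : ℝ :=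
  pmat σ a a + pmat σ b b - pmat σ a b - pmat σ b a

theorem dvec_form {n : ℕ} (A : Matrix (Fin n) (Fin n) ℝ) (a b : Fin n) :
    dotProduct (dvec a b) (A.mulVec (dvec a b)) = A a a + A b b - A a b - A b a := by
  simp [dotProduct, Matrix.mulVec, dvec, mul_sub, sub_mul, Finset.sum_sub_distrib]
  ring

theorem fix_swap {n : ℕ} (σ : Equiv.Perm (Fin n)) (a b : Fin n) :
    (fixCount (σ * Equiv.swap a b) : ℝ) = fixCount σ - qform σ a b := by
  rw [← trace_pmat, pmat_mul, pmat_swap, mul_sub, mul_one, Matrix.trace_sub, trace_pmat,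
    Matrix.mul_vecMulVec, Matrix.trace_vecMulVec, dotProduct_comm, dvec_form, qform]

theorem fix2_swap {n : ℕ} (σ : Equiv.Perm (Fin n)) (a b : Fin n) :
    (fixCount ((σ * Equiv.swap a b) * (σ * Equiv.swap a b)) : ℝ)
      = fixCount (σ * σ) - 2 * qform (σ * σ) a b + qform σ a b ^ 2 := by
  have hq : qform (σ * σ) a b = dotProduct (dvec a b) ((pmat σ * pmat σ).mulVec (dvec a b)) := by
    rw [dvec_form, qform, pmat_mul]
  have hq1 : qform σ a b = dotProduct (dvec a b) ((pmat σ).mulVec (dvec a b)) := by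
    rw [dvec_form, qform]
  rw [← trace_pmat, pmat_mul, pmat_mul, pmat_swap, ← trace_pmat, pmat_mul, hq, hq1]
  set P := pmat σ
  set v := dvec a b
  have e : P * (1 - Matrix.vecMulVec v v) * (P * (1 - Matrix.vecMulVec v v))
      = P * P - P * P * Matrix.vecMulVec v v - P * Matrix.vecMulVec v v * P
        + (P * Matrix.vecMulVec v v) * (P * Matrix.vecMulVec v v) := by
    noncomm_ring
  have e2 : (P * Matrix.vecMulVec v v * P).trace = (P * P * Matrix.vecMulVec v v).trace := by
    rw [Matrix.trace_mul_comm, ← mul_assoc]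
  rw [e, Matrix.trace_add, Matrix.trace_sub, Matrix.trace_sub, e2]
  simp only [Matrix.mul_vecMulVec, Matrix.trace_vecMulVec, Matrix.vecMulVec_mulVec]
  simp only [dotProduct_comm _ v]
  simp
  ring

theorem sum_qform {n : ℕ} (σ : Equiv.Perm (Fin n)) :
    ∑ a, ∑ b, qform σ a b = 2 * n * fixCount σ - 2 * n := by
  have h1 : ∑ i, pmat σ i i = fixCount σ := trace_pmat σ
  have h2 : ∑ a, ∑ b, pmat σ a b = n := by
    simp only [pmat_apply]
    rw [Finset.sum_comm]
    simp
  have h3 : ∑ a, ∑ b, pmat σ b a = n := by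
    simp [pmat_apply]
  simp only [qform, Finset.sum_sub_distrib, Finset.sum_add_distrib, h2, h3, h1, Finset.sum_const,
    ← Finset.smul_sum, Finset.card_univ, Fintype.card_fin, nsmul_eq_mul, ← Finset.mul_sum]
  ring

theorem sum_qform_sq {n : ℕ} (σ : Equiv.Perm (Fin n)) :
    ∑ a, ∑ b, qform σ a b ^ 2 = 2 * n + 2 * n * fixCount σ + 2 * fixCount (σ * σ)
      - 8 * fixCount σ + 2 * (fixCount σ : ℝ) ^ 2 := by
  have h1 : ∑ i, pmat σ i i = fixCount σ := trace_pmat σ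
  have h2 : ∑ a, ∑ b, pmat σ a b = n := by
    simp only [pmat_apply]
    rw [Finset.sum_comm]
    simp
  have h3 : ∑ a, ∑ b, pmat σ b a = n := by
    simp [pmat_apply]
  have h4 : ∑ a, ∑ b, pmat σ a b * pmat σ b a = fixCount (σ * σ) := by
    rw [← trace_pmat, pmat_mul]; simp [Matrix.trace, Matrix.mul_apply]
  have key : ∀ a b, qform σ a b ^ 2 = pmat σ a a + pmat σ b b + pmat σ a b + pmat σ b a
      + 2 * (pmat σ a a * pmat σ b b) + 2 * (pmat σ a b * pmat σ b a)
      - 8 * (if a = b then pmat σ a a else 0) := by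
    intro a b
    simp only [qform, pmat_apply]
    by_cases hab : a = b
    · subst hab
      by_cases h : σ a = a <;> simp [h]
      norm_num
    · by_cases h : σ a = a
      · have hb : σ b ≠ a := fun h' => hab (σ.injective (h.trans h'.symm))
        by_cases h' : σ b = b <;> simp [h, hab, h', Ne.symm hab, hb, eq_comm]
        all_goals first | norm_num | skip
      · by_cases h' : σ b = b
        · have hb : σ a ≠ b := fun h'' => hab (σ.injective (h''.trans h'.symm))
          simp [h, hab, h', Ne.symm hab, hb]
        · by_cases h3 : σ a = b <;> by_cases h4 : σ b = a <;> simp [h, hab, h', h3, h4, Ne.symm hab]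
          all_goals first | norm_num | skip
  simp only [key, Finset.sum_sub_distrib, Finset.sum_add_distrib, h2, h3, h1, Finset.sum_const,
    ← Finset.smul_sum, Finset.card_univ, Fintype.card_fin, nsmul_eq_mul, ← Finset.mul_sum, h4, ← Finset.sum_mul,
    Finset.sum_ite_eq, Finset.mem_univ, if_true]
  ring

theorem sum_swaps {n : ℕ} (φ : Equiv.Perm (Fin n) → ℝ) :
    ∑ a, ∑ b, φ (Equiv.swap a b) = n * φ 1 + 2 * ∑ τ ∈ transpositions n, φ τ := by
  classical
  have h0 : ∀ a b : Fin n, φ (Equiv.swap a b) =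
      (if a = b then φ 1 else 0) + (if a ≠ b then φ (Equiv.swap a b) else 0) := by
    intro a b
    by_cases h : a = b
    · subst h; simp; rfl
    · simp [h]
  have h1 : ∑ p ∈ (Finset.univ : Finset (Fin n × Fin n)).filter (fun p => p.1 ≠ p.2),
      φ (Equiv.swap p.1 p.2) = ∑ τ ∈ transpositions n, 2 * φ τ := by
    rw [← Finset.sum_fiberwise_of_maps_to (t := transpositions n)
      (g := fun p : Fin n × Fin n => Equiv.swap p.1 p.2)]
    · apply Finset.sum_congr rfl
      intro τ hτ
      have hsw : τ.IsSwap := by simpa [transpositions] using hτ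
      obtain ⟨x, y, hxy, rfl⟩ := hsw
      have : ((Finset.univ : Finset (Fin n × Fin n)).filter (fun p => p.1 ≠ p.2)).filter
          (fun p => Equiv.swap p.1 p.2 = Equiv.swap x y) = {(x, y), (y, x)} := by
        ext ⟨a, b⟩
        simp only [Finset.mem_filter, Finset.mem_univ, true_and, Finset.mem_insert,
          Finset.mem_singleton, Prod.mk.injEq]
        constructor
        · rintro ⟨hab, h⟩
          have ha : Equiv.swap x y a = b := by rw [← h]; simp
          rw [Equiv.swap_apply_def] at ha
          split_ifs at ha with h1 h2
          · exact Or.inl ⟨h1, ha.symm⟩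
          · exact Or.inr ⟨h2, ha.symm⟩
          · exact absurd ha hab
        · rintro (⟨rfl, rfl⟩ | ⟨rfl, rfl⟩)
          · exact ⟨hxy, rfl⟩
          · exact ⟨hxy.symm, Equiv.swap_comm _ _⟩
      rw [this, Finset.sum_pair (by simp [hxy])]
      simp only [Equiv.swap_comm y x]
      ring
    · rintro ⟨a, b⟩ h
      simp only [Finset.mem_filter, Finset.mem_univ, true_and] at h
      simp only [transpositions, Finset.mem_filter, Finset.mem_univ, true_and]
      exact ⟨a, b, h, rfl⟩
  rw [Finset.mul_sum, ← h1, Finset.sum_filter, ← Finset.univ_product_univ, Finset.sum_product]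
  rw [Finset.sum_congr rfl fun a _ => Finset.sum_congr rfl fun b _ => h0 a b]
  simp only [Finset.sum_add_distrib]
  simp

theorem card_transpositions (n : ℕ) :
    2 * ((transpositions n).card : ℝ) = n * (n - 1) := by
  have := sum_swaps (n := n) (fun _ => 1)
  simp at this
  linarith

/-- Averaging over transpositions multiplied by `n(n-1)`. -/
theorem avg_eq {n : ℕ} (hn : 2 ≤ n) (φ : Equiv.Perm (Fin n) → ℝ) (lam : ℝ) (σ : Equiv.Perm (Fin n))
    (h : ∑ a, ∑ b, φ (σ * Equiv.swap a b) = (n + n * (n - 1) * lam) * φ σ) :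
    ∑ τ, φ (σ * τ) * unifOn (transpositions n) τ = lam * φ σ := by
  have h1 := sum_swaps (fun τ => φ (σ * τ))
  simp only [mul_one] at h1
  have hc := card_transpositions n
  have hn' : (2 : ℝ) ≤ n := by exact_mod_cast hn
  have hpos : (0 : ℝ) < (transpositions n).card := by nlinarith
  have h2 : ∑ τ, φ (σ * τ) * unifOn (transpositions n) τ
      = (∑ τ ∈ transpositions n, φ (σ * τ)) / (transpositions n).card := by
    simp [unifOn, Finset.sum_ite_mem, Finset.sum_mul, div_eq_mul_inv]
  rw [h2, div_eq_iff hpos.ne']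
  have : ((transpositions n).card : ℝ) = n * (n - 1) / 2 := by linarith
  rw [this]
  linarith

theorem sum_conv {n : ℕ} (ψ μ ν : Equiv.Perm (Fin n) → ℝ) :
    ∑ g, ψ g * conv μ ν g = ∑ g, (∑ h, ψ (g * h) * ν h) * μ g := by
  simp only [conv, Finset.mul_sum, Finset.sum_mul]
  rw [Finset.sum_comm]
  conv_rhs => rw [Finset.sum_comm]
  apply Finset.sum_congr rfl
  intro h _
  rw [← Equiv.sum_comp (Equiv.mulRight h)]
  apply Finset.sum_congr rfl
  intro g _
  simp
  ring

theorem sum_convPow {n : ℕ} (ψ τ : Equiv.Perm (Fin n) → ℝ) (lam : ℝ)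
    (h : ∀ x, ∑ y, ψ (x * y) * τ y = lam * ψ x) (t : ℕ) :
    ∑ g, ψ g * convPow τ t g = lam ^ t * ψ 1 := by
  induction t with
  | zero => simp [convPow]
  | succ t ih =>
    rw [convPow, sum_conv]
    simp only [h, mul_assoc, ← Finset.mul_sum, ih]
    ring

theorem sum_walk {n k t : ℕ} (φ : Equiv.Perm (Fin n) → ℝ) (lam C : ℝ)
    (h : ∀ x, ∑ y, φ (x * y) * unifOn (transpositions n) y = lam * φ x)
    (hne : (cycles n k).Nonempty) (hC : ∀ x ∈ cycles n k, φ x = C) :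
    ∑ σ, φ σ * walk n k t σ = lam ^ t * C := by
  rw [walk, sum_conv]
  have h1 : ∀ g, ∑ x, φ (g * x) * convPow (unifOn (transpositions n)) t x = lam ^ t * φ g := by
    intro g
    have := sum_convPow (fun x => φ (g * x)) (unifOn (transpositions n)) lam
      (fun x => by simpa [mul_assoc] using h (g * x)) t
    simpa using this
  simp only [h1]
  have hpos : ((cycles n k).card : ℝ) ≠ 0 := by
    exact_mod_cast hne.card_pos.ne'
  have h2 : ∀ g, lam ^ t * φ g * unifOn (cycles n k) g =
      if g ∈ cycles n k then lam ^ t * C * (1 / (cycles n k).card) else 0 := by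
    intro g
    by_cases hg : g ∈ cycles n k
    · simp [unifOn, hg, hC g hg]
    · simp [unifOn, hg]
  simp only [h2, Finset.sum_ite_mem, Finset.univ_inter, Finset.sum_const, nsmul_eq_mul]
  field_simp

theorem cycles_nonempty {n k : ℕ} (h : k + 3 ≤ n) : (cycles n k).Nonempty := by
  obtain ⟨g, hg⟩ := (Equiv.Perm.exists_with_cycleType_iff (Fin n) (m := {n - k})).2
    (by simp; omega)
  refine ⟨g, ?_⟩
  simp only [cycles, Finset.mem_filter, Finset.mem_univ, true_and]
  constructor
  · rw [← Equiv.Perm.card_cycleType_eq_one, hg]; simp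
  · rw [← Equiv.Perm.sum_cycleType, hg]; simp

theorem fix_of_cycle {n k : ℕ} (h : k + 3 ≤ n) {σ : Equiv.Perm (Fin n)} (hσ : σ ∈ cycles n k) :
    fixCount σ = k ∧ fixCount (σ * σ) = k := by
  simp only [cycles, Finset.mem_filter, Finset.mem_univ, true_and] at hσ
  obtain ⟨hc, hs⟩ := hσ
  have h1 : fixCount σ = k := by
    have : (Finset.univ.filter fun i => σ i = i) = σ.supportᶜ := by
      ext i; simp
    rw [fixCount, this, Finset.card_compl, hs, Fintype.card_fin]
    omega
  refine ⟨h1, ?_⟩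
  rw [← h1, fixCount, fixCount]
  congr 1
  ext i
  simp only [Finset.mem_filter, Finset.mem_univ, true_and]
  constructor
  · intro hi
    by_contra hne
    have h2 : σ ^ 2 = 1 := (hc.pow_eq_one_iff' hne).2 (by rw [pow_two]; exact hi)
    have h3 := orderOf_dvd_of_pow_eq_one h2
    rw [hc.orderOf, hs] at h3
    have := Nat.le_of_dvd (by norm_num) h3
    omega
  · intro hi
    simp [hi]

theorem second_moment {n k : ℕ} (h : k + 3 ≤ n) (t : ℕ) :
    ∑ σ : Equiv.Perm (Fin n), ((fixCount σ : ℝ)) ^ 2 * walk n k t σ =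
      2 + 3 * ((k : ℝ) - 1) * (((n : ℝ) - 3) / (n - 1)) ^ t
      + (k : ℝ) * (k - 3) / 2 * (((n : ℝ) - 4) / n) ^ t
      + ((k : ℝ) - 1) * (k - 2) / 2 * (((n : ℝ) - 5) / (n - 1)) ^ t := by
  have hn : (3 : ℝ) ≤ n := by exact_mod_cast (by omega : 3 ≤ n)
  have hn0 : (n : ℝ) ≠ 0 := by linarith
  have hn1 : (n : ℝ) - 1 ≠ 0 := by linarith
  have hne := cycles_nonempty h
  have S1 : ∀ σ : Equiv.Perm (Fin n), ∑ a, ∑ b, (fixCount (σ * Equiv.swap a b) : ℝ)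
      = n ^ 2 * fixCount σ - (2 * n * fixCount σ - 2 * n) := by
    intro σ
    simp only [fix_swap, Finset.sum_sub_distrib, sum_qform]
    simp
    ring
  have S2 : ∀ σ : Equiv.Perm (Fin n), ∑ a, ∑ b, (fixCount (σ * Equiv.swap a b) : ℝ) ^ 2
      = n ^ 2 * fixCount σ ^ 2 - 2 * fixCount σ * (2 * n * fixCount σ - 2 * n)
        + (2 * n + 2 * n * fixCount σ + 2 * fixCount (σ * σ)
      - 8 * fixCount σ + 2 * (fixCount σ : ℝ) ^ 2) := by
    intro σ
    simp only [fix_swap, sub_sq, Finset.sum_sub_distrib, Finset.sum_add_distrib, sum_qform_sq,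
      ← Finset.mul_sum, sum_qform]
    simp
    ring
  have S3 : ∀ σ : Equiv.Perm (Fin n),
      ∑ a, ∑ b, (fixCount ((σ * Equiv.swap a b) * (σ * Equiv.swap a b)) : ℝ)
      = n ^ 2 * fixCount (σ * σ) - 2 * (2 * n * fixCount (σ * σ) - 2 * n)
        + (2 * n + 2 * n * fixCount σ + 2 * fixCount (σ * σ)
      - 8 * fixCount σ + 2 * (fixCount σ : ℝ) ^ 2) := by
    intro σ
    simp only [fix2_swap, Finset.sum_sub_distrib, Finset.sum_add_distrib, sum_qform_sq,
      ← Finset.mul_sum, sum_qform]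
    simp
    ring
  have S0 : ∀ x : ℝ, ∑ _a : Fin n, ∑ _b : Fin n, x = n ^ 2 * x := by
    intro x; simp; ring
  have E0 := sum_walk (n := n) (k := k) (t := t) (fun _ => 1) 1 1
    (fun x => avg_eq (by omega) (fun _ => 1) 1 x (by rw [S0]; ring)) hne (fun _ _ => rfl)
  have E1 := sum_walk (n := n) (k := k) (t := t) (fun σ => (fixCount σ : ℝ) - 1)
    (((n : ℝ) - 3) / (n - 1)) (k - 1)
    (fun x => avg_eq (by omega) (fun σ => (fixCount σ : ℝ) - 1) _ x (by
      simp only [Finset.sum_sub_distrib, S1, S0]; field_simp; ring)) hne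
    (fun x hx => by simp only [(fix_of_cycle h hx).1])
  have E2 := sum_walk (n := n) (k := k) (t := t)
    (fun σ => (fixCount σ : ℝ) ^ 2 + fixCount (σ * σ) - 4 * fixCount σ)
    (((n : ℝ) - 4) / n) (k * (k - 3))
    (fun x => avg_eq (by omega)
      (fun σ => (fixCount σ : ℝ) ^ 2 + fixCount (σ * σ) - 4 * fixCount σ) _ x (by
      simp only [Finset.sum_sub_distrib, Finset.sum_add_distrib, ← Finset.mul_sum, S1, S2, S3]
      field_simp; ring)) hne
    (fun x hx => by simp only [(fix_of_cycle h hx).1, (fix_of_cycle h hx).2]; ring)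
  have E3 := sum_walk (n := n) (k := k) (t := t)
    (fun σ => (fixCount σ : ℝ) ^ 2 - fixCount (σ * σ) - 2 * fixCount σ + 2)
    (((n : ℝ) - 5) / (n - 1)) ((k - 1) * (k - 2))
    (fun x => avg_eq (by omega)
      (fun σ => (fixCount σ : ℝ) ^ 2 - fixCount (σ * σ) - 2 * fixCount σ + 2) _ x (by
      simp only [Finset.sum_sub_distrib, Finset.sum_add_distrib, ← Finset.mul_sum, S1, S2, S3, S0]
      field_simp; ring)) hne
    (fun x hx => by simp only [(fix_of_cycle h hx).1, (fix_of_cycle h hx).2]; ring)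
  have dec : ∑ σ : Equiv.Perm (Fin n), ((fixCount σ : ℝ)) ^ 2 * walk n k t σ
      = 2 * ∑ σ : Equiv.Perm (Fin n), 1 * walk n k t σ
        + 3 * ∑ σ : Equiv.Perm (Fin n), ((fixCount σ : ℝ) - 1) * walk n k t σ
        + (1 / 2) * ∑ σ : Equiv.Perm (Fin n),
            ((fixCount σ : ℝ) ^ 2 + fixCount (σ * σ) - 4 * fixCount σ) * walk n k t σ
        + (1 / 2) * ∑ σ : Equiv.Perm (Fin n),
            ((fixCount σ : ℝ) ^ 2 - fixCount (σ * σ) - 2 * fixCount σ + 2) * walk n k t σ := by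
    simp only [Finset.mul_sum, ← Finset.sum_add_distrib]
    apply Finset.sum_congr rfl
    intro σ _
    ring
  rw [dec, E0, E1, E2, E3]
  ring

theorem tendsto_floor_ratio (a : ℝ) (ha : 0 ≤ a) :
    Tendsto (fun n : ℕ => ((⌊a * (n : ℝ)⌋₊ : ℕ) : ℝ) / n) atTop (nhds a) :=
  (tendsto_nat_floor_mul_div_atTop ha).comp tendsto_natCast_atTop_atTop

theorem tendsto_pow_floor (a : ℝ) (ha : 0 ≤ a) (p q : ℝ) :
    Tendsto (fun n : ℕ => (((n : ℝ) - p) / (n - q)) ^ ⌊a * (n : ℝ)⌋₊) atTop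
      (nhds (Real.exp ((q - p) * a))) := by
  have hcast := tendsto_natCast_atTop_atTop (R := ℝ)
  have h0 : Tendsto (fun n : ℕ => (n : ℝ) - q) atTop atTop :=
    tendsto_atTop_add_const_right _ _ hcast
  have hp : Tendsto (fun n : ℕ => (n : ℝ) - p) atTop atTop :=
    tendsto_atTop_add_const_right _ _ hcast
  have hinv : Tendsto (fun n : ℕ => ((n : ℝ) - q)⁻¹) atTop (nhds 0) := h0.inv_tendsto_atTop
  have h1 : Tendsto (fun n : ℕ => (n : ℝ) * ((q - p) * ((n : ℝ) - q)⁻¹)) atTop (nhds (q - p)) := by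
    have : Tendsto (fun n : ℕ => (q - p) * (1 + q * ((n : ℝ) - q)⁻¹)) atTop
        (nhds ((q - p) * (1 + q * 0))) :=
      ((hinv.const_mul q).const_add 1).const_mul (q - p)
    simp only [mul_zero, add_zero, mul_one] at this
    refine this.congr' ?_
    filter_upwards [h0.eventually_gt_atTop 0] with n hn
    field_simp
    ring
  have h2 := Real.tendsto_one_add_pow_exp_of_tendsto h1
  have h3 := h2.rpow (tendsto_floor_ratio a ha) (Or.inl (Real.exp_pos _).ne')
  rw [← Real.exp_mul] at h3
  refine h3.congr' ?_
  filter_upwards [h0.eventually_gt_atTop 0, hp.eventually_gt_atTop 0, hcast.eventually_gt_atTop 0]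
    with n hn hn' hn0
  have e : 1 + (q - p) * ((n : ℝ) - q)⁻¹ = ((n : ℝ) - p) / (n - q) := by
    field_simp; ring
  have hpos : 0 ≤ ((n : ℝ) - p) / (n - q) := by positivity
  rw [e, ← Real.rpow_natCast, ← Real.rpow_mul hpos, mul_div_cancel₀ _ hn0.ne', Real.rpow_natCast]

theorem moment_limit (k : ℕ) (hk : 2 ≤ k) (c : ℝ) (hc : 0 < c) :
    Filter.Tendsto
      (fun n : ℕ => ∑ σ : Equiv.Perm (Fin n), ((fixCount σ : ℝ)) ^ 2 *
        walk n k ⌊c * (n : ℝ) + (n : ℝ) / 2 * Real.log k⌋₊ σ)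
      Filter.atTop
      (nhds (2 + 3 * (((k : ℝ) - 1) / k) * Real.exp (-2 * c) +
        (((k : ℝ) ^ 2 - 3 * k + 1) / (k : ℝ) ^ 2) * Real.exp (-4 * c))) := by
  have hk' : (2 : ℝ) ≤ k := by exact_mod_cast hk
  have hk0 : (0 : ℝ) < k := by linarith
  have hl : 0 ≤ Real.log k := Real.log_nonneg (by linarith)
  set a := c + Real.log k / 2 with ha
  have ha0 : 0 ≤ a := by positivity
  have hf : ∀ n : ℕ, c * (n : ℝ) + (n : ℝ) / 2 * Real.log k = a * n := by
    intro n; rw [ha]; ring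
  simp only [hf]
  have x1 : Real.exp ((1 - 3) * a) = Real.exp (-2 * c) / k := by
    rw [show (1 - 3) * a = -2 * c - Real.log k by rw [ha]; ring, Real.exp_sub, Real.exp_log hk0]
  have x2 : ∀ y : ℝ, y = -4 → Real.exp (y * a) = Real.exp (-4 * c) / (k : ℝ) ^ 2 := by
    rintro y rfl
    rw [show -4 * a = -4 * c - Real.log k - Real.log k by rw [ha]; ring, Real.exp_sub,
      Real.exp_sub, Real.exp_log hk0]
    field_simp
  have t1 := tendsto_pow_floor a ha0 3 1
  have t2 := tendsto_pow_floor a ha0 4 0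
  have t3 := tendsto_pow_floor a ha0 5 1
  rw [x1] at t1
  rw [x2 _ (by norm_num)] at t2 t3
  have T := ((((t1.const_mul (3 * ((k : ℝ) - 1))).const_add 2).add
    (t2.const_mul ((k : ℝ) * (k - 3) / 2))).add
    (t3.const_mul (((k : ℝ) - 1) * (k - 2) / 2)))
  have hlim : 2 + 3 * ((k : ℝ) - 1) * (Real.exp (-2 * c) / k)
      + (k : ℝ) * (k - 3) / 2 * (Real.exp (-4 * c) / (k : ℝ) ^ 2)
      + ((k : ℝ) - 1) * (k - 2) / 2 * (Real.exp (-4 * c) / (k : ℝ) ^ 2)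
      = 2 + 3 * (((k : ℝ) - 1) / k) * Real.exp (-2 * c) +
        (((k : ℝ) ^ 2 - 3 * k + 1) / (k : ℝ) ^ 2) * Real.exp (-4 * c) := by
    ring
  rw [hlim] at T
  refine T.congr' ?_
  filter_upwards [eventually_ge_atTop (k + 3)] with n hn
  rw [second_moment hn]
  simp only [sub_zero]

/-- For fixed `k ≥ 2`, the second moment of the number of fixed points after a random
`(n-k)`-cycle and `t_n = ⌊cn + (n/2)ln k⌋` random transpositions converges to
`2 + (3/2)e^{-2c} - (1/4)e^{-4c}` if `k = 2`, to `2 + 2e^{-2c} + (1/9)e^{-4c}` if `k = 3`,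
and to `2 + 3((k-1)/k)e^{-2c} + ((k²-3k+1)/k²)e^{-4c}` if `k ≥ 4`. -/
theorem fixCount_second_moment_tendsto (k : ℕ) (hk : 2 ≤ k) (c : ℝ) (hc : 0 < c) :
    (k = 2 → Filter.Tendsto
      (fun n : ℕ => ∑ σ : Equiv.Perm (Fin n), ((fixCount σ : ℝ)) ^ 2 *
        walk n k ⌊c * (n : ℝ) + (n : ℝ) / 2 * Real.log k⌋₊ σ)
      Filter.atTop
      (nhds (2 + (3 / 2) * Real.exp (-2 * c) - (1 / 4) * Real.exp (-4 * c)))) ∧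
    (k = 3 → Filter.Tendsto
      (fun n : ℕ => ∑ σ : Equiv.Perm (Fin n), ((fixCount σ : ℝ)) ^ 2 *
        walk n k ⌊c * (n : ℝ) + (n : ℝ) / 2 * Real.log k⌋₊ σ)
      Filter.atTop
      (nhds (2 + 2 * Real.exp (-2 * c) + (1 / 9) * Real.exp (-4 * c)))) ∧
    (4 ≤ k → Filter.Tendsto
      (fun n : ℕ => ∑ σ : Equiv.Perm (Fin n), ((fixCount σ : ℝ)) ^ 2 *
        walk n k ⌊c * (n : ℝ) + (n : ℝ) / 2 * Real.log k⌋₊ σ)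
      Filter.atTop
      (nhds (2 + 3 * (((k : ℝ) - 1) / k) * Real.exp (-2 * c) +
        (((k : ℝ) ^ 2 - 3 * k + 1) / (k : ℝ) ^ 2) * Real.exp (-4 * c)))) := by
  have H := moment_limit k hk c hc
  refine ⟨?_, ?_, fun _ => H⟩
  · rintro rfl
    convert! H using 2
    push_cast
    ring
  · rintro rfl
    convert! H using 2
    push_cast
    ring
end

section
/- Let k = 2, fix a real number c > 0, and for each n set t_n = ⌊cn + (n/2)·ln 2⌋. Then lim_{n→∞} E_{μ_{t_n+1}}[fix³] = 5 + 5e^{−2c} − (3/2)e^{−4c} − (1/8)e^{−6c}. -/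
-- Common setup for the random (n-k)-cycle to transpositions walk on the symmetric group.
open Finset Filter Real

namespace W
noncomputable section
variable {n : ℕ}

def D (σ : Equiv.Perm (Fin n)) : Matrix (Fin n) (Fin n) ℝ :=
  Matrix.of fun i j => if i = σ j then 1 else 0

lemma D_mul (σ τ : Equiv.Perm (Fin n)) : D (σ * τ) = D σ * D τ := by
  ext i j
  simp [D, Matrix.mul_apply]
  congr

def U (a b : Fin n) : Matrix (Fin n) (Fin n) ℝ :=
  Matrix.vecMulVec (Pi.single a 1 - Pi.single b 1) (Pi.single a 1 - Pi.single b 1)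

def s (Z : Matrix (Fin n) (Fin n) ℝ) (a b : Fin n) : ℝ := Z a a + Z b b - Z a b - Z b a

lemma D_swap (a b : Fin n) : D (Equiv.swap a b) = 1 - U a b := by
  ext i j
  simp only [D, U, Matrix.of_apply, Matrix.sub_apply, Matrix.vecMulVec_apply, Matrix.one_apply,
    Pi.sub_apply, Pi.single_apply, Equiv.swap_apply_def]
  split_ifs <;> simp_all

lemma tr_U (Z : Matrix (Fin n) (Fin n) ℝ) (a b : Fin n) : (Z * U a b).trace = s Z a b := by
  simp only [U, Matrix.mul_vecMulVec, Matrix.trace_vecMulVec, s]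
  simp [Matrix.mulVec_sub, sub_dotProduct]
  ring

lemma U_U (Z : Matrix (Fin n) (Fin n) ℝ) (a b : Fin n) :
    U a b * Z * U a b = s Z a b • U a b := by
  rw [mul_assoc, ← tr_U]
  simp only [U, Matrix.mul_vecMulVec, Matrix.vecMulVec_mulVec, Matrix.trace_vecMulVec]
  ext i j
  simp only [Matrix.vecMulVec_apply, Matrix.smul_apply, smul_eq_mul, Pi.smul_apply]
  rw [dotProduct_comm]
  simp
  ring

def p (k : ℕ) (σ : Equiv.Perm (Fin n)) : ℝ := ((D σ)^k).trace

def q (k : ℕ) (σ : Equiv.Perm (Fin n)) (a b : Fin n) : ℝ := s ((D σ)^k) a b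

lemma p1_swap (σ : Equiv.Perm (Fin n)) (a b) :
    p 1 (σ * Equiv.swap a b) = p 1 σ - q 1 σ a b := by
  simp [p, q, D_mul, D_swap, mul_sub, tr_U]

lemma p2_swap (σ : Equiv.Perm (Fin n)) (a b) :
    p 2 (σ * Equiv.swap a b) = p 2 σ - 2 * q 2 σ a b + (q 1 σ a b)^2 := by
  simp only [p, q, D_mul, D_swap, pow_one, pow_two]
  set A := D σ
  have h1 : (A * U a b * A).trace = s (A * A) a b := by
    rw [Matrix.trace_mul_comm, ← mul_assoc, tr_U]
  have h2 : (A * U a b * (A * U a b)).trace = s A a b * s A a b := by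
    rw [mul_assoc, ← mul_assoc (U a b), U_U]; simp [tr_U]
  have h3 : (A * (A * U a b)).trace = s (A * A) a b := by
    rw [← mul_assoc, tr_U]
  simp only [mul_sub, sub_mul, mul_one, Matrix.trace_sub, h1, h2, h3]
  ring

lemma p3_swap (σ : Equiv.Perm (Fin n)) (a b) :
    p 3 (σ * Equiv.swap a b) = p 3 σ - 3 * q 3 σ a b + 3 * (q 1 σ a b * q 2 σ a b)
      - (q 1 σ a b)^3 := by
  simp only [p, q, D_mul, D_swap, pow_one, pow_two, pow_succ, pow_zero, one_mul]
  set A := D σ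
  set V := U a b with hV
  have e : ∀ Z, V * (Z * V) = s Z a b • V := fun Z => by rw [← mul_assoc, U_U]
  have e' : ∀ Z W, V * (Z * (W * V)) = s (Z * W) a b • V := fun Z W => by
    rw [← mul_assoc Z, e]
  have eX : ∀ Z X, V * (Z * (V * X)) = s Z a b • (V * X) := fun Z X => by
    rw [← mul_assoc, ← mul_assoc, U_U, Matrix.smul_mul]
  have t1 : ∀ Z, (Z * V).trace = s Z a b := fun Z => tr_U _ _ _
  have t2 : (A * (A * (A * V))).trace = s (A * (A * A)) a b := by
    rw [← tr_U]; simp only [mul_assoc, hV]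
  have t3 : (A * (A * (V * A))).trace = s (A * (A * A)) a b := by
    rw [← t2]; rw [Matrix.trace_mul_comm]
    simp only [mul_assoc]
    rw [Matrix.trace_mul_comm]; simp only [mul_assoc]
    rw [Matrix.trace_mul_comm]; simp only [mul_assoc]
  have t4 : (A * (V * (A * A))).trace = s (A * (A * A)) a b := by
    rw [← t2, Matrix.trace_mul_comm]
    simp only [mul_assoc]
    rw [Matrix.trace_mul_comm]; simp only [mul_assoc]
  have t5 : (A * (V * A)).trace = s (A * A) a b := by
    rw [← t1, Matrix.trace_mul_comm, mul_assoc, Matrix.trace_mul_comm]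
  have t6 : (A * (A * V)).trace = s (A * A) a b := by
    rw [← t1, mul_assoc]
  simp only [mul_sub, sub_mul, mul_one, Matrix.trace_sub, mul_assoc, e, e', eX, Matrix.trace_smul, Matrix.mul_smul,
    Matrix.smul_mul, t1, t2, t3, t4, t5, t6, smul_eq_mul]
  ring

lemma D_pow (σ : Equiv.Perm (Fin n)) (k : ℕ) : (D σ)^k = D (σ^k) := by
  induction k with
  | zero => ext i j; simp [D, Matrix.one_apply]
  | succ k ih => rw [pow_succ, ih, ← D_mul, pow_succ]

def d (σ : Equiv.Perm (Fin n)) (i j : Fin n) : ℝ := if i = σ j then 1 else 0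

lemma p_eq (k : ℕ) (σ : Equiv.Perm (Fin n)) : p k σ = ∑ a, d (σ^k) a a := by
  rw [p, D_pow]; rfl

lemma q_eq (k : ℕ) (σ : Equiv.Perm (Fin n)) (a b : Fin n) : q k σ a b =
    d (σ^k) a a + d (σ^k) b b - d (σ^k) a b - d (σ^k) b a := by
  rw [q, D_pow]; rfl

lemma sum_d' (σ : Equiv.Perm (Fin n)) : ∑ a, ∑ b, d σ b a = n := by
  simp [d]

lemma sum_d (σ : Equiv.Perm (Fin n)) : ∑ a, ∑ b, d σ a b = n := by
  rw [sum_comm]; exact sum_d' σ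

lemma sum_q (k : ℕ) (σ : Equiv.Perm (Fin n)) :
    ∑ a, ∑ b, q k σ a b = 2 * n * p k σ - 2 * n := by
  simp only [q_eq, sum_sub_distrib, sum_add_distrib, sum_d, sum_d', p_eq]
  simp [← mul_sum]; ring

lemma sum_dd (σ : Equiv.Perm (Fin n)) (j k : ℕ) :
   ∑ a, ∑ b, d (σ^j) a b * d (σ^k) b a = p (j+k) σ := by
  rw [p, pow_add, D_pow, D_pow]; rfl

lemma q1_sq (σ : Equiv.Perm (Fin n)) (a b : Fin n) : (q 1 σ a b)^2 =
    d σ a a + d σ b b + 2 * (d σ a a * d σ b b) + d σ a b + d σ b a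
      + 2 * (d σ a b * d σ b a) - 8 * (if a = b then d σ a a else 0) := by
  rw [q_eq, pow_one]
  by_cases h : a = b
  · subst h
    simp only [d]; split_ifs <;> norm_num
  · have h1 : ∀ c, ¬ (a = σ c ∧ b = σ c) := fun c hc => h (hc.1.trans hc.2.symm)
    have h2 : ∀ c, ¬ (c = σ a ∧ c = σ b) := fun c hc => h (σ.injective (hc.1.symm.trans hc.2))
    have := h1 a; have := h1 b; have := h2 a; have := h2 b
    simp only [d, if_neg h]; split_ifs <;> first | tauto | norm_num

lemma q1_cube (σ : Equiv.Perm (Fin n)) (a b : Fin n) : (q 1 σ a b)^3 =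
    d σ a a + d σ b b + 6 * (d σ a a * d σ b b) - d σ a b - d σ b a
      - 6 * (d σ a b * d σ b a) := by
  rw [q_eq, pow_one]
  by_cases h : a = b
  · subst h
    simp only [d]; split_ifs <;> norm_num
  · have h1 : ∀ c, ¬ (a = σ c ∧ b = σ c) := fun c hc => h (hc.1.trans hc.2.symm)
    have h2 : ∀ c, ¬ (c = σ a ∧ c = σ b) := fun c hc => h (σ.injective (hc.1.symm.trans hc.2))
    have := h1 a; have := h1 b; have := h2 a; have := h2 b
    simp only [d]; split_ifs <;> first | tauto | norm_num

lemma sum_dd1 (σ : Equiv.Perm (Fin n)) : ∑ a, ∑ b, d σ a b * d σ b a = p 2 σ := by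
  have := sum_dd σ 1 1
  simpa using this

lemma sum_prod (f g : Fin n → ℝ) : ∑ a, ∑ b, f a * g b = (∑ a, f a) * ∑ b, g b := by
  rw [sum_mul_sum]

lemma sum_prod' (f g : Fin n → ℝ) : ∑ a, ∑ b, f b * g a = (∑ a, f a) * ∑ b, g b := by
  rw [sum_comm, sum_mul_sum]

lemma p1_eq (σ : Equiv.Perm (Fin n)) : p 1 σ = ∑ a, d σ a a := by
  simpa using p_eq 1 σ

lemma sum_q1_sq (σ : Equiv.Perm (Fin n)) : ∑ a, ∑ b, (q 1 σ a b)^2 =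
    2 * n * p 1 σ + 2 * (p 1 σ)^2 - 8 * p 1 σ + 2 * n + 2 * p 2 σ := by
  simp only [q1_sq, sum_sub_distrib, sum_add_distrib, ← mul_sum, sum_d, sum_d', sum_dd1, sum_prod,
    p1_eq]
  simp [← mul_sum, ← sum_mul]; ring

lemma sum_q1_cube (σ : Equiv.Perm (Fin n)) : ∑ a, ∑ b, (q 1 σ a b)^3 =
    2 * n * p 1 σ + 6 * (p 1 σ)^2 - 2 * n - 6 * p 2 σ := by
  simp only [q1_cube, sum_sub_distrib, sum_add_distrib, ← mul_sum, sum_d, sum_d', sum_dd1, sum_prod,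
    p1_eq]
  simp [← mul_sum, ← sum_mul]; ring

lemma d_fix (σ : Equiv.Perm (Fin n)) (a : Fin n) : d σ a a * d (σ^2) a a = d σ a a := by
  simp only [d, pow_two, Equiv.Perm.mul_apply]
  by_cases h : a = σ a
  · simp [← h]
  · simp [h]

lemma d_fix1 (σ : Equiv.Perm (Fin n)) (a b : Fin n) :
    d σ a a * d (σ^2) a b = if a = b then d σ a a else 0 := by
  simp only [d, pow_two, Equiv.Perm.mul_apply]
  by_cases h : a = σ a
  · have : (a = σ (σ b)) ↔ a = b := by
      constructor
      · intro h'
        apply σ.injective; apply σ.injective; rw [← h', ← h, ← h]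
      · rintro rfl; rw [← h, ← h]
    simp [← h, this]
  · simp [h]

lemma d_fix2 (σ : Equiv.Perm (Fin n)) (a b : Fin n) :
    d σ a a * d (σ^2) b a = if a = b then d σ a a else 0 := by
  simp only [d, pow_two, Equiv.Perm.mul_apply]
  by_cases h : a = σ a
  · simp [← h, eq_comm]
  · simp [h]

lemma d_fix3 (σ : Equiv.Perm (Fin n)) (a b : Fin n) :
    d σ a b * d (σ^2) a b = if a = b then d σ a a else 0 := by
  simp only [d, pow_two, Equiv.Perm.mul_apply]
  by_cases h : a = σ b
  · rw [← h]
    by_cases h' : a = σ a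
    · have : a = b := σ.injective (h'.symm.trans h)
      subst this
      simp only [if_pos h', if_true, mul_one]
    · have : a ≠ b := by rintro rfl; exact h' h
      simp [h', this]
  · simp only [h, if_false, zero_mul]
    split_ifs with h1 h2
    · subst h1; exact absurd h2 h
    · rfl
    · rfl

lemma sum_row (σ : Equiv.Perm (Fin n)) (a : Fin n) : ∑ b, d σ a b = 1 := by
  have : ∀ b, d σ a b = if b = σ.symm a then 1 else 0 := fun b => by
    simp only [d, Equiv.eq_symm_apply, eq_comm]
  simp [this]

lemma sum_col (σ : Equiv.Perm (Fin n)) (a : Fin n) : ∑ b, d σ b a = 1 := by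
  simp [d]

lemma sum_q1q2 (σ : Equiv.Perm (Fin n)) : ∑ a, ∑ b, q 1 σ a b * q 2 σ a b =
    2 * n * p 1 σ + 2 * (p 1 σ * p 2 σ) - 2 * p 1 σ - 4 * p 2 σ + 2 * p 3 σ := by
  have key : ∀ a b, q 1 σ a b * q 2 σ a b =
      d σ a a + d σ b b + d σ a a * d (σ^2) b b + d σ b b * d (σ^2) a a
      - 2 * (if a = b then d σ a a else 0) - 2 * (if b = a then d σ b b else 0)
      - d (σ^2) a a * d σ a b - d (σ^2) a a * d σ b a
      - d (σ^2) b b * d σ a b - d (σ^2) b b * d σ b a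
      + (if a = b then d σ a a else 0) + (if b = a then d σ b b else 0)
      + d σ a b * d (σ^2) b a + d (σ^2) a b * d σ b a := by
    intro a b
    rw [q_eq, q_eq, pow_one]
    linear_combination d_fix σ a + d_fix σ b - d_fix1 σ a b - d_fix1 σ b a - d_fix2 σ a b
      - d_fix2 σ b a + d_fix3 σ a b + d_fix3 σ b a
  have h1 : ∑ a, ∑ b, d (σ^2) b b * d σ a b = p 2 σ := by
    rw [sum_comm]; simp only [← mul_sum, sum_col, mul_one, p_eq]
  have h2 : ∑ a, ∑ b, d (σ^2) b b * d σ b a = p 2 σ := by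
    rw [sum_comm]; simp only [← mul_sum, sum_row, mul_one, p_eq]
  have h3 := sum_dd σ 1 2
  have h4 := sum_dd σ 2 1
  rw [pow_one] at h3 h4
  simp only [key, sum_sub_distrib, sum_add_distrib, h1, h2, h3, h4, sum_prod, sum_prod', ← mul_sum,
    sum_row, sum_col, ← p_eq, ← p1_eq, mul_one]
  simp [← mul_sum, ← sum_mul, ← p1_eq]; ring

def m2 (σ : Equiv.Perm (Fin n)) : ℝ := (p 2 σ - p 1 σ) / 2
def m3 (σ : Equiv.Perm (Fin n)) : ℝ := (p 3 σ - p 1 σ) / 3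

lemma sum_all (σ : Equiv.Perm (Fin n)) (c0 c1 c2 c3 c4 c5 c6 : ℝ) :
    ∑ a, ∑ b, (c0 + c1 * q 1 σ a b + c2 * q 2 σ a b + c3 * q 3 σ a b + c4 * (q 1 σ a b)^2
      + c5 * (q 1 σ a b * q 2 σ a b) + c6 * (q 1 σ a b)^3) =
    c0 * n^2 + c1 * (2 * n * p 1 σ - 2 * n) + c2 * (2 * n * p 2 σ - 2 * n)
     + c3 * (2 * n * p 3 σ - 2 * n)
     + c4 * (2 * n * p 1 σ + 2 * (p 1 σ)^2 - 8 * p 1 σ + 2 * n + 2 * p 2 σ)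
     + c5 * (2 * n * p 1 σ + 2 * (p 1 σ * p 2 σ) - 2 * p 1 σ - 4 * p 2 σ + 2 * p 3 σ)
     + c6 * (2 * n * p 1 σ + 6 * (p 1 σ)^2 - 2 * n - 6 * p 2 σ) := by
  simp only [sum_add_distrib, ← mul_sum, sum_q, sum_q1_sq, sum_q1q2, sum_q1_cube]
  simp; ring

/-- eigenfunction of the (lazy, unnormalised) transposition operator -/
def Eig (F : Equiv.Perm (Fin n) → ℝ) (e : ℝ) : Prop :=
  ∀ σ, ∑ a, ∑ b, F (σ * Equiv.swap a b) = e * F σ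

def x1 (σ : Equiv.Perm (Fin n)) : ℝ := p 1 σ - 1
def x2 (σ : Equiv.Perm (Fin n)) : ℝ := p 1 σ * (p 1 σ - 3) / 2 + m2 σ
def x11 (σ : Equiv.Perm (Fin n)) : ℝ := (p 1 σ - 1) * (p 1 σ - 2) / 2 - m2 σ
def x3 (σ : Equiv.Perm (Fin n)) : ℝ :=
  p 1 σ * (p 1 σ - 1) * (p 1 σ - 5) / 6 + m2 σ * (p 1 σ - 1) + m3 σ
def x21 (σ : Equiv.Perm (Fin n)) : ℝ := p 1 σ * (p 1 σ - 2) * (p 1 σ - 4) / 3 - m3 σ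
def x111 (σ : Equiv.Perm (Fin n)) : ℝ :=
  (p 1 σ - 1) * (p 1 σ - 2) * (p 1 σ - 3) / 6 - (p 1 σ - 1) * m2 σ + m3 σ

lemma cube_eq (σ : Equiv.Perm (Fin n)) : (p 1 σ)^3 =
    5 * 1 + 10 * x1 σ + 6 * x2 σ + 6 * x11 σ + x3 σ + 2 * x21 σ + x111 σ := by
  simp only [x1, x2, x11, x3, x21, x111, m2, m3]; ring

lemma eig_of (F : Equiv.Perm (Fin n) → ℝ) (e : ℝ)
    (h : ∀ σ, ∃ c1 c2 c3 c4 c5 c6 : ℝ,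
      (∀ a b, F (σ * Equiv.swap a b) = F σ + c1 * q 1 σ a b + c2 * q 2 σ a b + c3 * q 3 σ a b
      + c4 * (q 1 σ a b)^2 + c5 * (q 1 σ a b * q 2 σ a b) + c6 * (q 1 σ a b)^3) ∧
      F σ * n^2 + c1 * (2 * n * p 1 σ - 2 * n) + c2 * (2 * n * p 2 σ - 2 * n)
     + c3 * (2 * n * p 3 σ - 2 * n)
     + c4 * (2 * n * p 1 σ + 2 * (p 1 σ)^2 - 8 * p 1 σ + 2 * n + 2 * p 2 σ)
     + c5 * (2 * n * p 1 σ + 2 * (p 1 σ * p 2 σ) - 2 * p 1 σ - 4 * p 2 σ + 2 * p 3 σ)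
     + c6 * (2 * n * p 1 σ + 6 * (p 1 σ)^2 - 2 * n - 6 * p 2 σ) = e * F σ) : Eig F e := by
  intro σ
  obtain ⟨c1, c2, c3, c4, c5, c6, h1, h2⟩ := h σ
  simp only [h1, sum_all, h2]

lemma eig_one : Eig (fun _ : Equiv.Perm (Fin n) => (1:ℝ)) ((n:ℝ)^2) := by
  intro σ; simp; ring

lemma eig_x1 : Eig (x1 (n := n)) (n + (n-1) * (n-2) - 2) := by
  refine eig_of _ _ fun σ => ⟨-1, 0, 0, 0, 0, 0, fun a b => ?_, ?_⟩
  · simp only [x1, p1_swap]; ring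
  · simp only [x1]; ring

lemma eig_x2 : Eig (x2 (n := n)) (n + (n-2) * (n-3) - 2) := by
  refine eig_of _ _ fun σ => ⟨2 - p 1 σ, -1, 0, 1, 0, 0, fun a b => ?_, ?_⟩
  · simp only [x2, m2, p1_swap, p2_swap]; ring
  · simp only [x2, m2]; ring

lemma eig_x11 : Eig (x11 (n := n)) (n + (n-2) * (n-3) - 6) := by
  refine eig_of _ _ fun σ => ⟨1 - p 1 σ, 1, 0, 0, 0, 0, fun a b => ?_, ?_⟩
  · simp only [x11, m2, p1_swap, p2_swap]; ring
  · simp only [x11, m2]; ring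

lemma eig_x3 : Eig (x3 (n := n)) (n + (n-3) * (n-4)) := by
  refine eig_of _ _ fun σ => ⟨(-3 * p 1 σ^2 + 12 * p 1 σ - 5)/6 - m2 σ + (p 1 σ - 1)/2 + 1/3,
    1 - p 1 σ, -1, p 1 σ - 2, 2, -1, fun a b => ?_, ?_⟩
  · simp only [x3, m2, m3, p1_swap, p2_swap, p3_swap]; ring
  · simp only [x3, m2, m3]; ring

lemma eig_x21 : Eig (x21 (n := n)) (n + (n-3) * (n-4) - 6) := by
  refine eig_of _ _ fun σ => ⟨(-3 * p 1 σ^2 + 12 * p 1 σ - 8)/3 - 1/3,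
    0, 1, p 1 σ - 2, -1, 0, fun a b => ?_, ?_⟩
  · simp only [x21, m2, m3, p1_swap, p2_swap, p3_swap]; ring
  · simp only [x21, m2, m3]; ring

lemma eig_x111 : Eig (x111 (n := n)) (n + (n-3) * (n-4) - 12) := by
  refine eig_of _ _ fun σ => ⟨(-3 * p 1 σ^2 + 12 * p 1 σ - 11)/6 + m2 σ - (p 1 σ - 1)/2 + 1/3,
    p 1 σ - 1, -1, 0, 0, 0, fun a b => ?_, ?_⟩
  · simp only [x111, m2, m3, p1_swap, p2_swap, p3_swap]; ring
  · simp only [x111, m2, m3]; ring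

/-! Convolution -/

lemma sum_conv (F μ ν : Equiv.Perm (Fin n) → ℝ) :
    ∑ g, F g * conv μ ν g = ∑ k, (∑ h, F (k * h) * ν h) * μ k := by
  simp only [conv, mul_sum, sum_mul]
  rw [sum_comm]
  conv_rhs => rw [sum_comm]
  refine sum_congr rfl fun h _ => ?_
  rw [← Equiv.sum_comp (Equiv.mulRight h)]
  refine sum_congr rfl fun k _ => ?_
  simp; ring

lemma sum_convPow (F τ : Equiv.Perm (Fin n) → ℝ) (l : ℝ)
    (h : ∀ σ, ∑ g, F (σ * g) * τ g = l * F σ) (t : ℕ) (σ : Equiv.Perm (Fin n)) :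
    ∑ g, F (σ * g) * convPow τ t g = l^t * F σ := by
  induction t generalizing σ with
  | zero => simp [convPow]
  | succ t ih =>
    rw [convPow, sum_conv (fun g => F (σ * g))]
    simp only [← mul_assoc, h]
    simp only [mul_assoc, ← mul_sum, ih]
    ring

lemma swap_fiber (G : Equiv.Perm (Fin n) → ℝ) :
    ∑ a, ∑ b, G (Equiv.swap a b) = n * G 1 + 2 * ∑ g ∈ transpositions n, G g := by
  classical
  rw [← sum_product']
  rw [← sum_filter_add_sum_filter_not (univ ×ˢ univ) (fun x : Fin n × Fin n => x.1 = x.2)]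
  congr 1
  · have : ∀ x ∈ (univ ×ˢ univ).filter (fun x : Fin n × Fin n => x.1 = x.2),
        G (Equiv.swap x.1 x.2) = G 1 := by
      intro x hx
      simp at hx
      rw [hx, Equiv.swap_self]; rfl
    rw [sum_congr rfl this, sum_const, nsmul_eq_mul]
    congr 2
    rw [univ_product_univ]
    have : (univ.filter (fun x : Fin n × Fin n => x.1 = x.2)) = univ.diag := by
      ext x; simp
    rw [this]; simp
  · rw [mul_sum]
    have hm : ∀ x ∈ (univ ×ˢ univ).filter (fun x : Fin n × Fin n => ¬ x.1 = x.2),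
        Equiv.swap x.1 x.2 ∈ transpositions n := by
      intro x hx
      simp at hx
      simp only [transpositions, mem_filter, mem_univ, true_and]
      exact ⟨x.1, x.2, hx, rfl⟩
    rw [← sum_fiberwise_of_maps_to hm]
    refine sum_congr rfl fun g hg => ?_
    simp only [transpositions, mem_filter, mem_univ, true_and] at hg
    obtain ⟨x, y, hxy, rfl⟩ := hg
    have : ((univ ×ˢ univ).filter (fun x : Fin n × Fin n => ¬ x.1 = x.2)).filter
        (fun z => Equiv.swap z.1 z.2 = Equiv.swap x y) = {(x, y), (y, x)} := by
      ext ⟨u, v⟩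
      simp only [mem_filter, mem_product, mem_univ, true_and, mem_insert, mem_singleton,
        Prod.mk.injEq]
      constructor
      · rintro ⟨h1, h2⟩
        have h3 : Equiv.swap x y u = v := by rw [← h2, Equiv.swap_apply_left]
        rw [Equiv.swap_apply_def] at h3
        split_ifs at h3 with h4 h5
        · exact Or.inl ⟨h4, h3.symm⟩
        · exact Or.inr ⟨h5, h3.symm⟩
        · exact absurd h3 h1
      · rintro (⟨rfl, rfl⟩ | ⟨rfl, rfl⟩)
        · exact ⟨hxy, rfl⟩
        · exact ⟨Ne.symm hxy, Equiv.swap_comm _ _⟩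
    rw [this, sum_pair (by simp [hxy]), Equiv.swap_comm y x]; ring

lemma card_transpositions : 2 * ((transpositions n).card : ℝ) = n * (n - 1) := by
  have := swap_fiber (n := n) (fun _ => 1)
  simp at this
  linarith

lemma eig_step (hn : 2 ≤ n) (F : Equiv.Perm (Fin n) → ℝ) (e : ℝ) (h : Eig F e)
    (σ : Equiv.Perm (Fin n)) :
    ∑ g, F (σ * g) * unifOn (transpositions n) g = ((e - n) / (n * (n - 1))) * F σ := by
  have h1 := swap_fiber (fun g => F (σ * g))
  rw [h σ] at h1
  have hc := card_transpositions (n := n)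
  have hn' : (2:ℝ) ≤ n := by exact_mod_cast hn
  have hpos : (0:ℝ) < n * (n - 1) := mul_pos (by linarith) (by linarith)
  have hc' : ((transpositions n).card : ℝ) = n * (n - 1) / 2 := by linarith
  simp only [unifOn, mul_ite, mul_zero, sum_ite_mem, univ_inter, ← sum_mul, hc']
  have : ∑ g ∈ transpositions n, F (σ * g) = (e - n) * F σ / 2 := by
    rw [mul_one] at h1; linarith
  rw [this]
  field_simp

lemma walk_eig (hn : 2 ≤ n) (k t : ℕ) (F : Equiv.Perm (Fin n) → ℝ) (e : ℝ) (h : Eig F e) (v : ℝ)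
    (hv : ∀ σ ∈ cycles n k, F σ = v) (hne : (cycles n k).Nonempty) :
    ∑ σ, F σ * walk n k t σ = ((e - n) / (n * (n - 1)))^t * v := by
  rw [walk, sum_conv]
  simp only [sum_convPow F _ _ (eig_step hn F e h)]
  simp only [unifOn, mul_ite, mul_zero, sum_ite_mem, univ_inter]
  have : ∀ σ ∈ cycles n k, ((e - n) / (n * (n - 1)))^t * F σ * (1 / ((cycles n k).card : ℝ)) =
      ((e - n) / (n * (n - 1)))^t * v * (1 / ((cycles n k).card : ℝ)) := fun σ hσ => by
    rw [hv σ hσ]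
  rw [sum_congr rfl this, sum_const, nsmul_eq_mul]
  have : ((cycles n k).card : ℝ) ≠ 0 := by exact_mod_cast hne.card_ne_zero
  field_simp

lemma cycles_nonempty (hn : 6 ≤ n) : (cycles n 2).Nonempty := by
  obtain ⟨g, hg⟩ := (Equiv.Perm.exists_with_cycleType_iff (Fin n) (m := {n - 2})).2
    ⟨by simp, by simp; omega⟩
  refine ⟨g, ?_⟩
  simp only [cycles, mem_filter, mem_univ, true_and]
  refine ⟨?_, ?_⟩
  · rw [← Equiv.Perm.card_cycleType_eq_one, hg]; simp
  · rw [← Equiv.Perm.sum_cycleType, hg]; simp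

lemma p_fix (k : ℕ) (σ : Equiv.Perm (Fin n)) : p k σ = fixCount (σ^k) := by
  rw [p_eq]; simp [d, fixCount, eq_comm]

lemma p_cycle (hn : 6 ≤ n) (σ : Equiv.Perm (Fin n)) (h : σ ∈ cycles n 2) (k : ℕ) (hk : 0 < k)
    (hk' : k < 4) : p k σ = 2 := by
  simp only [cycles, mem_filter, mem_univ, true_and] at h
  have h1 := h.1.support_pow_of_pos_of_lt_orderOf hk (by rw [h.1.orderOf, h.2]; omega)
  rw [p_fix]
  have h2 : fixCount (σ^k) = ((σ^k).support)ᶜ.card := by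
    rw [fixCount]; congr 1; ext i; simp
  rw [h2, card_compl, h1, h.2, Fintype.card_fin]
  have : n - (n - 2) = 2 := by omega
  rw [this]; norm_num

lemma moment (hn : 6 ≤ n) (t : ℕ) :
    ∑ σ : Equiv.Perm (Fin n), ((fixCount σ : ℝ)) ^ 3 * walk n 2 t σ =
    5 + 10 * (((n + (n-1) * (n-2) - 2 : ℝ) - n) / (n * (n - 1)))^t
      - 6 * (((n + (n-2) * (n-3) - 2 : ℝ) - n) / (n * (n - 1)))^t
      - (((n + (n-3) * (n-4) : ℝ) - n) / (n * (n - 1)))^t := by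
  have hne := cycles_nonempty hn
  have hn2 : 2 ≤ n := by omega
  have hp : ∀ σ ∈ cycles n 2, p 1 σ = 2 ∧ p 2 σ = 2 ∧ p 3 σ = 2 := fun σ hσ =>
    ⟨p_cycle hn σ hσ 1 (by norm_num) (by norm_num), p_cycle hn σ hσ 2 (by norm_num) (by norm_num),
      p_cycle hn σ hσ 3 (by norm_num) (by norm_num)⟩
  have w0 := walk_eig hn2 2 t _ _ eig_one 1 (fun _ _ => rfl) hne
  have w1 := walk_eig hn2 2 t _ _ eig_x1 1 (fun σ hσ => by
    obtain ⟨a, b, c⟩ := hp σ hσ; simp only [x1, a]; norm_num) hne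
  have w2 := walk_eig hn2 2 t _ _ eig_x2 (-1) (fun σ hσ => by
    obtain ⟨a, b, c⟩ := hp σ hσ; simp only [x2, m2, a, b]; norm_num) hne
  have w11 := walk_eig hn2 2 t _ _ eig_x11 0 (fun σ hσ => by
    obtain ⟨a, b, c⟩ := hp σ hσ; simp only [x11, m2, a, b]; norm_num) hne
  have w3 := walk_eig hn2 2 t _ _ eig_x3 (-1) (fun σ hσ => by
    obtain ⟨a, b, c⟩ := hp σ hσ; simp only [x3, m2, m3, a, b, c]; norm_num) hne
  have w21 := walk_eig hn2 2 t _ _ eig_x21 0 (fun σ hσ => by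
    obtain ⟨a, b, c⟩ := hp σ hσ; simp only [x21, m2, m3, a, b, c]; norm_num) hne
  have w111 := walk_eig hn2 2 t _ _ eig_x111 0 (fun σ hσ => by
    obtain ⟨a, b, c⟩ := hp σ hσ; simp only [x111, m2, m3, a, b, c]; norm_num) hne
  have hf : ∀ σ : Equiv.Perm (Fin n), (fixCount σ : ℝ) = p 1 σ := fun σ => by
    rw [p_fix, pow_one]
  have hn' : (6:ℝ) ≤ n := by exact_mod_cast hn
  have e0 : (((n:ℝ)^2 - n) / (n * (n - 1))) = 1 := by
    rw [div_eq_one_iff_eq (mul_pos (by linarith) (by linarith)).ne']; ring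
  rw [e0, one_pow] at w0
  simp only [hf, cube_eq, add_mul, sum_add_distrib, mul_assoc, ← mul_sum, w0, w1, w2, w11, w3, w21,
    w111]
  ring

lemma lim_pow (c : ℝ) (hc : 0 < c) (l : ℕ → ℝ) (r : ℝ)
    (hl : Tendsto (fun n : ℕ => (n:ℝ) * (l n - 1)) atTop (nhds r)) :
    Tendsto (fun n : ℕ => (l n)^⌊c * (n : ℝ) + (n : ℝ) / 2 * Real.log 2⌋₊) atTop
      (nhds (Real.exp (r * (c + Real.log 2 / 2)))) := by
  have h1 := Real.tendsto_one_add_pow_exp_of_tendsto hl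
  have hlog : 0 < Real.log 2 := Real.log_pos (by norm_num)
  have h2 : Tendsto (fun n : ℕ => (⌊c * (n : ℝ) + (n : ℝ) / 2 * Real.log 2⌋₊ : ℝ) / n) atTop
      (nhds (c + Real.log 2 / 2)) := by
    have := (tendsto_nat_floor_mul_div_atTop (R := ℝ) (a := c + Real.log 2 / 2)
      (by positivity)).comp tendsto_natCast_atTop_atTop
    refine this.congr fun n => ?_
    simp only [Function.comp]
    congr 4; ring
  have h3 := h1.rpow h2 (Or.inl (Real.exp_pos r).ne')
  rw [← Real.exp_mul] at h3
  have h0 : Tendsto l atTop (nhds 1) := by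
    have := (hl.mul (tendsto_inv_atTop_nhds_zero_nat (𝕜 := ℝ))).add_const 1
    rw [mul_zero, zero_add] at this
    refine this.congr' ?_
    filter_upwards [eventually_gt_atTop 0] with n hn
    have : (n:ℝ) ≠ 0 := by exact_mod_cast hn.ne'
    field_simp; ring
  refine h3.congr' ?_
  filter_upwards [eventually_gt_atTop 0, h0.eventually (eventually_gt_nhds zero_lt_one)] with n hn hp
  have : (n:ℝ) ≠ 0 := by exact_mod_cast hn.ne'
  rw [add_sub_cancel, ← Real.rpow_natCast (l n) n, ← Real.rpow_mul hp.le, mul_div_cancel₀ _ this,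
    Real.rpow_natCast]

lemma lim_rat (l : ℕ → ℝ) (r s : ℝ)
    (h : ∀ n : ℕ, 6 ≤ n → (n:ℝ) * (l n - 1) = (r * n + s) / (n - 1)) :
    Tendsto (fun n : ℕ => (n:ℝ) * (l n - 1)) atTop (nhds r) := by
  have h1 : Tendsto (fun n : ℕ => r + (r + s) * ((n:ℝ) - 1)⁻¹) atTop (nhds (r + (r + s) * 0)) := by
    refine Tendsto.const_add _ (Tendsto.const_mul _ ?_)
    exact tendsto_inv_atTop_zero.comp
      (tendsto_atTop_add_const_right _ (-1) tendsto_natCast_atTop_atTop)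
  rw [mul_zero, add_zero] at h1
  refine h1.congr' ?_
  filter_upwards [eventually_ge_atTop 6] with n hn
  have hn' : (6:ℝ) ≤ n := by exact_mod_cast hn
  have : (n:ℝ) - 1 ≠ 0 := by linarith
  rw [h n hn]; field_simp; ring

end
end W

/-- For `k = 2`, the third moment of the number of fixed points after a random
`(n-2)`-cycle and `t_n = ⌊cn + (n/2)ln 2⌋` random transpositions converges to
`5 + 5e^{-2c} - (3/2)e^{-4c} - (1/8)e^{-6c}`. -/
theorem fixCount_third_moment_tendsto (c : ℝ) (hc : 0 < c) :
    Filter.Tendsto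
      (fun n : ℕ => ∑ σ : Equiv.Perm (Fin n), ((fixCount σ : ℝ)) ^ 3 *
        walk n 2 ⌊c * (n : ℝ) + (n : ℝ) / 2 * Real.log 2⌋₊ σ)
      Filter.atTop
      (nhds (5 + 5 * Real.exp (-2 * c) - (3 / 2) * Real.exp (-4 * c) -
        (1 / 8) * Real.exp (-6 * c))) := by
  have key : ∀ (j s : ℝ) (l : ℕ → ℝ),
      (∀ n : ℕ, 6 ≤ n → (n:ℝ) * (l n - 1) = (-2 * j * n + s) / (n - 1)) →
      Tendsto (fun n : ℕ => (l n)^⌊c * (n : ℝ) + (n : ℝ) / 2 * Real.log 2⌋₊) atTop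
        (nhds (Real.exp (-2 * j * c) * Real.exp (- Real.log 2 * j))) := by
    intro j s l h
    have := W.lim_pow c hc l (-2 * j) (W.lim_rat l _ s h)
    rw [← Real.exp_add]
    convert this using 3
    ring
  have l1 := key 1 0 (fun n => ((n + (n-1) * (n-2) - 2 : ℝ) - n) / (n * (n - 1))) (by
    intro n hn
    have hn' : (6:ℝ) ≤ n := by exact_mod_cast hn
    have : (n:ℝ) - 1 ≠ 0 := by linarith
    have : (n:ℝ) ≠ 0 := by linarith
    field_simp; ring)
  have l2 := key 2 4 (fun n => ((n + (n-2) * (n-3) - 2 : ℝ) - n) / (n * (n - 1))) (by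
    intro n hn
    have hn' : (6:ℝ) ≤ n := by exact_mod_cast hn
    have : (n:ℝ) - 1 ≠ 0 := by linarith
    have : (n:ℝ) ≠ 0 := by linarith
    field_simp; ring)
  have l3 := key 3 12 (fun n => ((n + (n-3) * (n-4) : ℝ) - n) / (n * (n - 1))) (by
    intro n hn
    have hn' : (6:ℝ) ≤ n := by exact_mod_cast hn
    have : (n:ℝ) - 1 ≠ 0 := by linarith
    have : (n:ℝ) ≠ 0 := by linarith
    field_simp; ring)
  have hj : ∀ j : ℕ, Real.exp (- Real.log 2 * j) = (1/2)^j := by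
    intro j
    rw [mul_comm, Real.exp_nat_mul, Real.exp_neg, Real.exp_log (by norm_num)]; norm_num
  have hj1 := hj 1
  have hj2 := hj 2
  have hj3 := hj 3
  push_cast at hj1 hj2 hj3
  rw [hj1] at l1
  rw [hj2] at l2
  rw [hj3] at l3
  have fin := (((l1.const_mul 10).const_add 5).sub (l2.const_mul 6)).sub l3
  have hval : 5 + 10 * (Real.exp (-2 * 1 * c) * (1/2)^1) - 6 * (Real.exp (-2 * 2 * c) * (1/2)^2)
      - Real.exp (-2 * 3 * c) * (1/2)^3 = 5 + 5 * Real.exp (-2 * c) - (3 / 2) * Real.exp (-4 * c) -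
        (1 / 8) * Real.exp (-6 * c) := by
    norm_num; ring
  rw [hval] at fin
  refine fin.congr' ?_
  filter_upwards [eventually_ge_atTop 6] with n hn
  rw [W.moment hn]
end
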